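/- Let P, Q ∈ SYT(r×c), n = rc, S = stack(P,Q), and let λ(x,y) for 0 ≤ x, y ≤ n (Cartesian coordinates) denote the (n+1)×(n+1) northeast block of partitions of PEdiagram(S) (the block whose unit-square decorations form PM(S)^NE). Then the chain λ(0,0) → λ(0,1) → ⋯ → λ(0,n) equals the evacuation ∂(P) as a chain of partitions, and the chain λ(0,0) → λ(1,0) → ⋯ → λ(n,0) equals Q as a chain of partitions. -/

import Mathlib

namespace PromRS

/-! ## Rectangular standard Young tableaux (as functions; 0-indexed cells; entries 1..R*C) -/

/-- `T` is a standard Young tableau of rectangular shape with `R` rows and `C` columns: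
rows and columns strictly increase, and the entries on the `R × C` rectangle are a
bijection onto `{1, …, R*C}`. -/
def IsSYT (R C : ℕ) (T : ℕ → ℕ → ℕ) : Prop :=
  (∀ i j, i < R → j + 1 < C → T i j < T i (j + 1)) ∧
  (∀ i j, i + 1 < R → j < C → T i j < T (i + 1) j) ∧
  Set.BijOn (fun p : ℕ × ℕ => T p.1 p.2) {p : ℕ × ℕ | p.1 < R ∧ p.2 < C} (Set.Icc 1 (R * C))

/-- Stacking: add `r*c` to every entry of `Q` and place the result below `P`. -/
def stack (r c : ℕ) (P Q : ℕ → ℕ → ℕ) : ℕ → ℕ → ℕ := fun i j =>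
  if i < r then P i j else Q (i - r) j + r * c

/-! ## Gromotion and promotion permutations -/

/-- Value of `T` at a cell, with `⊤` outside the `R × C` rectangle. -/
def ext (R C : ℕ) (T : ℕ → ℕ → ℕ) (p : ℕ × ℕ) : WithTop ℕ :=
  if p.1 < R ∧ p.2 < C then ((T p.1 p.2 : ℕ) : WithTop ℕ) else ⊤

/-- The jeu de taquin slide moves the empty cell to the smaller of its east/south neighbors. -/
def nextCell (R C : ℕ) (T : ℕ → ℕ → ℕ) (p : ℕ × ℕ) : ℕ × ℕ :=
  if ext R C T (p.1, p.2 + 1) < ext R C T (p.1 + 1, p.2) then (p.1, p.2 + 1)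
  else (p.1 + 1, p.2)

/-- The sliding path of the empty cell, starting at the top-left corner. -/
def slidePath (R C : ℕ) (T : ℕ → ℕ → ℕ) : ℕ → ℕ × ℕ
  | 0 => (0, 0)
  | k + 1 => nextCell R C T (slidePath R C T k)

def maxEntry (R C : ℕ) (T : ℕ → ℕ → ℕ) : ℕ :=
  ((Finset.range R) ×ˢ (Finset.range C)).sup fun p => T p.1 p.2

/-- Gromotion: delete the minimal entry (at the top-left corner), rectify by jeu de taquin
slides, and fill the vacated outer corner with (current maximum) + 1; entries are not
decremented. -/
def gromotion (R C : ℕ) (T : ℕ → ℕ → ℕ) : ℕ → ℕ → ℕ := fun i j =>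
  if i = R - 1 ∧ j = C - 1 then maxEntry R C T + 1
  else
    match (List.range (R + C - 2)).find? (fun k => decide (slidePath R C T k = (i, j))) with
    | some k => T (slidePath R C T (k + 1)).1 (slidePath R C T (k + 1)).2
    | none => T i j

/-- The entry that slides (up) into row `i` (1-indexed) during one gromotion slide of `T`:
the value of `T` at the first cell of the sliding path lying in 0-indexed row `i`. -/
def slideInto (R C : ℕ) (T : ℕ → ℕ → ℕ) (i : ℕ) : ℕ :=
  match (List.range (R + C - 1)).find? (fun k => decide ((slidePath R C T k).1 = i)) with
  | some k => T (slidePath R C T k).1 (slidePath R C T k).2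
  | none => 0

/-- The `i`-th promotion permutation of `T ∈ SYT(R × C)`: its value at `j` is the entry
that slides into row `i` when computing `gromotion^j(T)`, taken modulo `R*C` with
residues in `{1, …, R*C}`. -/
def promPerm (R C : ℕ) (T : ℕ → ℕ → ℕ) (i : ℕ) : ℕ → ℕ := fun j =>
  (slideInto R C ((gromotion R C)^[j - 1] T) i - 1) % (R * C) + 1

/-! ## Tableaux as lists of rows, Robinson–Schensted insertion -/

/-- Entry of a list-of-rows tableau (0-indexed; `0` outside). -/
def entryL (T : List (List ℕ)) (i j : ℕ) : ℕ := (T.getD i []).getD j 0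

/-- Convert a function tableau on an `R × C` rectangle to a list of rows. -/
def toListT (R C : ℕ) (T : ℕ → ℕ → ℕ) : List (List ℕ) :=
  (List.range R).map fun i => (List.range C).map fun j => T i j

/-- Transpose (conjugate) of a list-of-rows tableau. -/
def transposeT (T : List (List ℕ)) : List (List ℕ) :=
  (List.range (T.getD 0 []).length).map fun j => T.filterMap fun row => row[j]?

/-- Shape (row lengths) of a list-of-rows tableau. -/
def shapeL (T : List (List ℕ)) : List ℕ := T.map List.length

/-- Standard Young tableau, as a list of rows: weakly decreasing nonempty row lengths,
rows and columns strictly increasing, and entries exactly `{1, …, N}` where `N` is the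
number of cells. -/
def IsSYTList (T : List (List ℕ)) : Prop :=
  (∀ i, i + 1 < T.length → (T.getD (i + 1) []).length ≤ (T.getD i []).length) ∧
  (∀ row ∈ T, row ≠ []) ∧
  (∀ i j, i < T.length → j + 1 < (T.getD i []).length → entryL T i j < entryL T i (j + 1)) ∧
  (∀ i j, i + 1 < T.length → j < (T.getD (i + 1) []).length →
    entryL T i j < entryL T (i + 1) j) ∧
  T.flatten.Nodup ∧ (∀ m, m ∈ T.flatten ↔ 1 ≤ m ∧ m ≤ T.flatten.length)

/-- Schensted row insertion of `x` into a tableau. -/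
def rowInsert : List (List ℕ) → ℕ → List (List ℕ)
  | [], x => [[x]]
  | r :: rs, x =>
    match r.dropWhile (fun y => decide (y < x)) with
    | [] => (r ++ [x]) :: rs
    | y :: bs => (r.takeWhile (fun y => decide (y < x)) ++ x :: bs) :: rowInsert rs y

/-- The (0-indexed) row where the shape grew when passing from `P` to `P'`. -/
def rowOfNewCell (P P' : List (List ℕ)) : ℕ :=
  ((List.range P'.length).find? fun i =>
    decide ((P'.getD i []).length ≠ (P.getD i []).length)).getD 0

def placeInRow (Q : List (List ℕ)) (r k : ℕ) : List (List ℕ) :=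
  if r < Q.length then Q.set r (Q.getD r [] ++ [k]) else Q ++ [[k]]

/-- The Robinson–Schensted correspondence: the pair (insertion tableau, recording tableau)
of a word. -/
def RS (w : List ℕ) : List (List ℕ) × List (List ℕ) :=
  (List.range w.length).foldl
    (fun PQ i =>
      let P' := rowInsert PQ.1 (w.getD i 0)
      (P', placeInRow PQ.2 (rowOfNewCell PQ.1 P') (i + 1)))
    ([], [])

/-! ## Jeu de taquin on list tableaux; evacuation -/

def extL (T : List (List ℕ)) (p : ℕ × ℕ) : WithTop ℕ :=
  if p.2 < (T.getD p.1 []).length then ((entryL T p.1 p.2 : ℕ) : WithTop ℕ) else ⊤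

def nextCellL (T : List (List ℕ)) (p : ℕ × ℕ) : ℕ × ℕ :=
  if extL T (p.1, p.2 + 1) = ⊤ ∧ extL T (p.1 + 1, p.2) = ⊤ then p
  else if extL T (p.1, p.2 + 1) < extL T (p.1 + 1, p.2) then (p.1, p.2 + 1)
  else (p.1 + 1, p.2)

def jdtPath (T : List (List ℕ)) : ℕ → ℕ × ℕ
  | 0 => (0, 0)
  | k + 1 => nextCellL T (jdtPath T k)

/-- The outer corner vacated when the minimal entry of `T` is deleted and the tableau is
rectified by jeu de taquin slides. -/
def vacated (T : List (List ℕ)) : ℕ × ℕ := jdtPath T T.flatten.length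

/-- The value at cell `(i, j)` after the rectification slide. -/
def slidValue (T : List (List ℕ)) (i j : ℕ) : ℕ :=
  match (List.range T.flatten.length).find? (fun k =>
      decide (jdtPath T k = (i, j) ∧ jdtPath T (k + 1) ≠ (i, j))) with
  | some k => entryL T (jdtPath T (k + 1)).1 (jdtPath T (k + 1)).2
  | none => entryL T i j

/-- Delete the minimal entry of `T` and rectify. -/
def delta (T : List (List ℕ)) : List (List ℕ) :=
  ((List.range T.length).map fun i =>
    (List.range ((T.getD i []).length - if i = (vacated T).1 then 1 else 0)).map fun j =>
      slidValue T i j).filter fun row => decide (row ≠ [])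

/-- The entry of the evacuation `∂T` at cell `(i,j)`: `n + 1 - k` where the `k`-th
deletion-rectification vacates `(i,j)`. -/
def evacEntry (T : List (List ℕ)) (i j : ℕ) : ℕ :=
  match (List.range T.flatten.length).find? (fun k =>
      decide (vacated (delta^[k] T) = (i, j))) with
  | some k => T.flatten.length - k
  | none => 0

/-- Schützenberger evacuation `∂T` of a standard Young tableau. -/
def evacL (T : List (List ℕ)) : List (List ℕ) :=
  (List.range T.length).map fun i =>
    (List.range (T.getD i []).length).map fun j => evacEntry T i j

/-! ## Shadow lines, skeleta, and Viennot's construction -/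

def dirNE (a b : ℤ × ℤ) : Prop := a.1 ≤ b.1 ∧ a.2 ≤ b.2
def dirSE (a b : ℤ × ℤ) : Prop := a.1 ≤ b.1 ∧ b.2 ≤ a.2
def dirSW (a b : ℤ × ℤ) : Prop := b.1 ≤ a.1 ∧ b.2 ≤ a.2
def dirNW (a b : ℤ × ℤ) : Prop := b.1 ≤ a.1 ∧ a.2 ≤ b.2

def minimalsUnder (d : ℤ × ℤ → ℤ × ℤ → Prop) (P : Set (ℤ × ℤ)) : Set (ℤ × ℤ) :=
  {p ∈ P | ∀ q ∈ P, d q p → q = p}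

/-- `P` minus its first `j` shadow lines. -/
def shadowRest (d : ℤ × ℤ → ℤ × ℤ → Prop) (P : Set (ℤ × ℤ)) : ℕ → Set (ℤ × ℤ)
  | 0 => P
  | j + 1 => shadowRest d P j \ minimalsUnder d (shadowRest d P j)

/-- The `j`-th shadow line of `P` (1-indexed `j`). -/
def shadowLine (d : ℤ × ℤ → ℤ × ℤ → Prop) (P : Set (ℤ × ℤ)) (j : ℕ) : Set (ℤ × ℤ) :=
  minimalsUnder d (shadowRest d P (j - 1))

/-- The skeleton of a single shadow line `L`: the minimal elements of the set of points
covered by the shadows of at least two points of `L`. -/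
def lineSkeleton (d : ℤ × ℤ → ℤ × ℤ → Prop) (L : Set (ℤ × ℤ)) : Set (ℤ × ℤ) :=
  minimalsUnder d {x | ∃ p ∈ L, ∃ q ∈ L, p ≠ q ∧ d p x ∧ d q x}

/-- The skeleton of `P`: the union of the skeleta of its shadow lines. -/
def skeleton (d : ℤ × ℤ → ℤ × ℤ → Prop) (P : Set (ℤ × ℤ)) : Set (ℤ × ℤ) :=
  ⋃ j : ℕ, lineSkeleton d (shadowLine d P (j + 1))

/-- The `k`-th iterated skeleton of `P`. -/
def skeletonIter (d : ℤ × ℤ → ℤ × ℤ → Prop) (P : Set (ℤ × ℤ)) (k : ℕ) : Set (ℤ × ℤ) :=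
  (skeleton d)^[k] P

def IsMinSnd (L : Set (ℤ × ℤ)) (y : ℤ) : Prop := (∃ p ∈ L, p.2 = y) ∧ ∀ p ∈ L, y ≤ p.2
def IsMaxSnd (L : Set (ℤ × ℤ)) (y : ℤ) : Prop := (∃ p ∈ L, p.2 = y) ∧ ∀ p ∈ L, p.2 ≤ y
def IsMinFst (L : Set (ℤ × ℤ)) (x : ℤ) : Prop := (∃ p ∈ L, p.1 = x) ∧ ∀ p ∈ L, x ≤ p.1
def IsMaxFst (L : Set (ℤ × ℤ)) (x : ℤ) : Prop := (∃ p ∈ L, p.1 = x) ∧ ∀ p ∈ L, p.1 ≤ x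

/-- The set of exit coordinates (specified by `spec`) of the shadow lines of the `i`-th
iterated skeleton of `P` in direction `d`. -/
def exitSet (spec : Set (ℤ × ℤ) → ℤ → Prop) (d : ℤ × ℤ → ℤ × ℤ → Prop)
    (P : Set (ℤ × ℤ)) (i : ℕ) : Set ℤ :=
  {v | ∃ j : ℕ, spec (shadowLine d (skeletonIter d P i) (j + 1)) v}

/-- The word read off along one edge in Viennot's construction is the lattice word of the
standard tableau `T`: there is an enumeration `e` of all shadow-line exit coordinates,
in the order prescribed by `lt`, such that the `m`-th exit belongs to a shadow line of the
`i`-th iterated skeleton exactly when the entry `m` of `T` lies in row `i + 1`. -/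
def ReadsWord (spec : Set (ℤ × ℤ) → ℤ → Prop) (lt : ℤ → ℤ → Prop)
    (d : ℤ × ℤ → ℤ × ℤ → Prop) (P : Set (ℤ × ℤ)) (T : List (List ℕ)) : Prop :=
  ∃ e : Fin T.flatten.length → ℤ,
    (∀ a b : Fin T.flatten.length, a < b → lt (e a) (e b)) ∧
    (Set.range e = ⋃ i : ℕ, exitSet spec d P i) ∧
    ∀ (m : Fin T.flatten.length) (i : ℕ), e m ∈ exitSet spec d P i →
      (T.findIdx fun row => row.contains (m.1 + 1)) + 1 = i + 1

/-- `𝒱(𝒫, ↗) = (Pt, Qt)`: the P-word is read bottom-to-top along the right edge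
(east exit heights, which are the minimal `y`-coordinates of the lines), the Q-word
left-to-right along the top edge (north exits at minimal `x`-coordinates). -/
def ViennotNE (P : Set (ℤ × ℤ)) (Pt Qt : List (List ℕ)) : Prop :=
  ReadsWord IsMinSnd (· < ·) dirNE P Pt ∧ ReadsWord IsMinFst (· < ·) dirNE P Qt

/-- `𝒱(𝒫, ↘) = (Pt, Qt)`: P-word left-to-right along the bottom edge, Q-word
top-to-bottom along the right edge. -/
def ViennotSE (P : Set (ℤ × ℤ)) (Pt Qt : List (List ℕ)) : Prop :=
  ReadsWord IsMinFst (· < ·) dirSE P Pt ∧ ReadsWord IsMaxSnd (· > ·) dirSE P Qt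

/-- `𝒱(𝒫, ↙) = (Pt, Qt)`: P-word bottom-to-top along the left edge, Q-word
right-to-left along the bottom edge. -/
def ViennotSW (P : Set (ℤ × ℤ)) (Pt Qt : List (List ℕ)) : Prop :=
  ReadsWord IsMaxSnd (· < ·) dirSW P Pt ∧ ReadsWord IsMaxFst (· > ·) dirSW P Qt

/-- `𝒱(𝒫, ↖) = (Pt, Qt)`: P-word right-to-left along the top edge, Q-word
bottom-to-top along the left edge. -/
def ViennotNW (P : Set (ℤ × ℤ)) (Pt Qt : List (List ℕ)) : Prop :=
  ReadsWord IsMaxFst (· > ·) dirNW P Pt ∧ ReadsWord IsMinSnd (· < ·) dirNW P Qt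

/-- The point set `𝒫^NE(ρ)` of the northeast `n × n` block of the permutation matrix of
`ρ ∈ S_{2n}`, in Cartesian coordinates. -/
def pointsNE (n : ℕ) (f : ℕ → ℕ) : Set (ℤ × ℤ) :=
  {p | ∃ x : ℕ, 1 ≤ x ∧ x ≤ n ∧ n < f x ∧ p = ((f x : ℤ) - n, (n : ℤ) + 1 - x)}

/-! ## Crossings and nestings of perfect matchings -/

/-- The matching `{a, f a}` on `{1, …, N}` has a `k`-crossing:
blocks `{a₁ < b₁}, …, {a_k < b_k}` with `a₁ < ⋯ < a_k < b₁ < ⋯ < b_k`. -/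
def HasCrossing (f : ℕ → ℕ) (N k : ℕ) : Prop :=
  ∃ a b : Fin k → ℕ, StrictMono a ∧ StrictMono b ∧
    (∀ m, 1 ≤ a m ∧ b m ≤ N ∧ f (a m) = b m ∧ a m < b m) ∧
    ∀ m m' : Fin k, a m < b m'

/-- The matching `{a, f a}` on `{1, …, N}` has a `k`-nesting:
blocks `{a₁ < b₁}, …, {a_k < b_k}` with `a₁ < ⋯ < a_k < b_k < ⋯ < b₁`. -/
def HasNesting (f : ℕ → ℕ) (N k : ℕ) : Prop :=
  ∃ a b : Fin k → ℕ, StrictMono a ∧ StrictAnti b ∧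
    (∀ m, 1 ≤ a m ∧ b m ≤ N ∧ f (a m) = b m ∧ a m < b m) ∧
    ∀ m m' : Fin k, a m < b m'

/-! ## Local rules, the promotion–evacuation diagram, and the promotion matrix -/

/-- Partitions are encoded as lists of row lengths (fixed length, padded by zeros). -/
def sortDesc (l : List ℕ) : List ℕ := List.insertionSort (· ≥ ·) l

/-- The sequence `ν + κ - λ` (pointwise). -/
def ruleSeq (lam nu ka : List ℕ) : List ℕ :=
  List.zipWith (fun a b => a - b) (List.zipWith (· + ·) nu ka) lam

/-- The local rule: `μ = sort(ν + κ - λ)`. -/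
def localRule (lam nu ka : List ℕ) : List ℕ := sortDesc (ruleSeq lam nu ka)

/-- The decoration of a local rule square: `i` if `ν + κ - λ` fails to be sorted at rows
`i, i+1` (1-indexed), and `0` if no decoration is present. -/
def decoration (lam nu ka : List ℕ) : ℕ :=
  match (List.range (ruleSeq lam nu ka).length).find? (fun i =>
      decide ((ruleSeq lam nu ka).getD i 0 < (ruleSeq lam nu ka).getD (i + 1) 0)) with
  | some i => i + 1
  | none => 0

/-- Fill in the next row of the promotion–evacuation diagram from the previous row `prev`:
the new row starts with the empty partition at position `s` and continues by local rules. -/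
def nextRow (R : ℕ) (prev : ℕ → List ℕ) (s : ℕ) : ℕ → List ℕ
  | 0 => List.replicate R 0
  | x + 1 =>
    if x + 1 ≤ s then List.replicate R 0
    else localRule (prev x) (prev (x + 1)) (nextRow R prev s x)

/-- The `j`-th row of the promotion–evacuation diagram of `T ∈ SYT(R × C)`, as a function
of the column index (row `0` is the chain of `T`). -/
def PErow (R C : ℕ) (T : ℕ → ℕ → ℕ) : ℕ → ℕ → List ℕ
  | 0 => fun x => (List.range R).map fun i =>
      ((Finset.range C).filter fun j => T i j ≤ min x (R * C)).card
  | j + 1 => nextRow R (PErow R C T j) (j + 1)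

/-- For `S = stack(P, Q) ∈ SYT(2r × c)` and `n = r*c`, the `(n+1) × (n+1)` northeast block
of partitions `λ(x, y)` of `PEdiagram(S)` (Cartesian coordinates): `λ(x,y)` is the
diagram entry in row `n - y`, column `n + x`. -/
def lamBlock (r c : ℕ) (S : ℕ → ℕ → ℕ) (x y : ℕ) : List ℕ :=
  PErow (2 * r) c S (r * c - y) (r * c + x)

/-- The entry of `PM(S)^NE` at Cartesian coordinates `(x, y)`, `1 ≤ x, y ≤ n`: the
decoration of the local rule square with corners `λ(x-1, y-1)`, `λ(x-1, y)`, `λ(x, y-1)`,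
`λ(x, y)`. -/
def PMNE (r c : ℕ) (S : ℕ → ℕ → ℕ) (x y : ℕ) : ℕ :=
  decoration (lamBlock r c S (x - 1) y) (lamBlock r c S x y) (lamBlock r c S (x - 1) (y - 1))

/-- Chain of partitions of a list tableau: shape of the entries `≤ m`. -/
def chainOfL (T : List (List ℕ)) (m : ℕ) : List ℕ :=
  T.map fun row => (row.filter fun a => decide (a ≤ m)).length

/-- Column height `#{i : j < l i}` of a partition. -/
def colHeight (l : List ℕ) (j : ℕ) : ℕ := (l.filter fun a => decide (j < a)).length

/-- Vertical sum `l +' m` of two partitions (stack the columns of `m` onto those of `l`),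
computed inside a `rows × cols` bounding box. -/
def vsum (rows cols : ℕ) (l m : List ℕ) : List ℕ :=
  (List.range rows).map fun i =>
    ((List.range cols).filter fun j => decide (i < colHeight l j + colHeight m j)).length

/-! ## The point sets `S_k` and `S_{kj}` -/

/-- `x_{sj}`: the entry of `Q` in row `s`, column `j` (1-indexed). -/
def xEnt (Q : ℕ → ℕ → ℕ) (s j : ℕ) : ℤ := (Q (s - 1) (j - 1) : ℤ)

/-- `y_{tj}`: the entry of `∂(P)` in row `t`, column `j` (1-indexed). -/
def yEnt (r c : ℕ) (P : ℕ → ℕ → ℕ) (t j : ℕ) : ℤ :=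
  (entryL (evacL (toListT r c P)) (t - 1) (j - 1) : ℤ)

def Skj (r c : ℕ) (P Q : ℕ → ℕ → ℕ) (k j : ℕ) : Set (ℤ × ℤ) :=
  {p | ∃ s t : ℕ, 1 ≤ s ∧ s ≤ r ∧ 1 ≤ t ∧ t ≤ r ∧ s + t - 1 = k ∧
    p = (xEnt Q s j, yEnt r c P t j)}

def Sk (r c : ℕ) (P Q : ℕ → ℕ → ℕ) (k : ℕ) : Set (ℤ × ℤ) :=
  ⋃ j ∈ Set.Icc 1 c, Skj r c P Q k j

/-- A southeast chain of `k` ones in the matrix `U` (rows increase, columns increase),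
contained in a rectangle that fully fits into the strictly upper triangular part of the
`N × N` matrix. -/
def HasSEChain (U : ℕ → ℕ → ℕ) (N k : ℕ) : Prop :=
  ∃ a b : Fin k → ℕ, StrictMono a ∧ StrictMono b ∧ (∀ m, U (a m) (b m) = 1) ∧
    ∃ r₁ r₂ c₁ c₂ : ℕ, 1 ≤ r₁ ∧ r₂ < c₁ ∧ c₂ ≤ N ∧
      ∀ m, r₁ ≤ a m ∧ a m ≤ r₂ ∧ c₁ ≤ b m ∧ b m ≤ c₂

/-- A southwest chain of `k` ones in the matrix `U` (rows increase, columns decrease),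
contained in a rectangle that fully fits into the strictly upper triangular part of the
`N × N` matrix. -/
def HasSWChain (U : ℕ → ℕ → ℕ) (N k : ℕ) : Prop :=
  ∃ a b : Fin k → ℕ, StrictMono a ∧ StrictAnti b ∧ (∀ m, U (a m) (b m) = 1) ∧
    ∃ r₁ r₂ c₁ c₂ : ℕ, 1 ≤ r₁ ∧ r₂ < c₁ ∧ c₂ ≤ N ∧
      ∀ m, r₁ ≤ a m ∧ a m ≤ r₂ ∧ c₁ ≤ b m ∧ b m ≤ c₂

/-- Length of the `i`-th row of a list tableau (`0` outside). -/
def rowLen (T : List (List ℕ)) (i : ℕ) : ℕ := (T.getD i []).length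

/-- The entry of a list tableau at a cell. -/
def entryAt (T : List (List ℕ)) (p : ℕ × ℕ) : ℕ := entryL T p.1 p.2

/-- The cell `p` belongs to the shape of `T`. -/
def InShape (T : List (List ℕ)) (p : ℕ × ℕ) : Prop := p.2 < rowLen T p.1

/-- `T` is a standard filling of a partition shape with entries exactly `a + 1, …, b`. -/
structure StdOn (T : List (List ℕ)) (a b : ℕ) : Prop where
  anti : ∀ i, rowLen T (i + 1) ≤ rowLen T i
  row : ∀ i j, InShape T (i, j + 1) → entryAt T (i, j) < entryAt T (i, j + 1)
  col : ∀ i j, InShape T (i + 1, j) → entryAt T (i, j) < entryAt T (i + 1, j)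
  mem : ∀ p, InShape T p → a < entryAt T p ∧ entryAt T p ≤ b
  surj : ∀ m, a < m → m ≤ b → ∃ p, InShape T p ∧ entryAt T p = m
  inj : ∀ p q, InShape T p → InShape T q → entryAt T p = entryAt T q → p = q
  size : T.flatten.length = b - a

theorem extL_of_inShape {T : List (List ℕ)} {p : ℕ × ℕ} (h : InShape T p) :
    extL T p = ((entryAt T p : ℕ) : WithTop ℕ) := if_pos h

theorem extL_of_not_inShape {T : List (List ℕ)} {p : ℕ × ℕ} (h : ¬ InShape T p) :
    extL T p = ⊤ := if_neg h

namespace StdOn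

variable {T : List (List ℕ)} {a b : ℕ}

theorem antitone_rowLen (h : StdOn T a b) : Antitone (rowLen T) :=
  antitone_nat_of_succ_le h.anti

theorem nextCellL_cases (h : StdOn T a b) (i j : ℕ) :
    (nextCellL T (i, j) = (i, j) ∧ ¬ InShape T (i, j + 1) ∧ ¬ InShape T (i + 1, j)) ∨
    (nextCellL T (i, j) = (i, j + 1) ∧ InShape T (i, j + 1) ∧
      (InShape T (i + 1, j) → entryAt T (i, j + 1) < entryAt T (i + 1, j))) ∨
    (nextCellL T (i, j) = (i + 1, j) ∧ InShape T (i + 1, j) ∧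
      (InShape T (i, j + 1) → entryAt T (i + 1, j) < entryAt T (i, j + 1))) := by
  have hne : InShape T (i, j + 1) → InShape T (i + 1, j) →
      entryAt T (i, j + 1) ≠ entryAt T (i + 1, j) := fun h1 h2 he => by
    simpa using h.inj _ _ h1 h2 he
  by_cases h1 : InShape T (i, j + 1) <;> by_cases h2 : InShape T (i + 1, j)
  · have := hne h1 h2
    simp only [nextCellL, extL_of_inShape h1, extL_of_inShape h2, h1, h2, Nat.cast_lt]
    simp only [WithTop.natCast_ne_top, false_and, if_false]
    split_ifs with h3
    · simp [h3]
    · simp; omega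
  · simp [nextCellL, extL_of_inShape h1, extL_of_not_inShape h2, h1, h2]
  · simp [nextCellL, extL_of_not_inShape h1, extL_of_inShape h2, h1, h2]
  · simp [nextCellL, extL_of_not_inShape h1, extL_of_not_inShape h2, h1, h2]

theorem inShape_nextCellL (h : StdOn T a b) {p : ℕ × ℕ} (hp : InShape T p) :
    InShape T (nextCellL T p) := by
  rcases h.nextCellL_cases p.1 p.2 with h | h | h <;> simp_all

theorem entryAt_lt_nextCellL (h : StdOn T a b) {p : ℕ × ℕ} (hn : nextCellL T p ≠ p) :
    entryAt T p < entryAt T (nextCellL T p) := by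
  obtain ⟨i, j⟩ := p
  rcases h.nextCellL_cases i j with h1 | h1 | h1
  · exact absurd h1.1 hn
  · rw [h1.1]; exact h.row _ _ h1.2.1
  · rw [h1.1]; exact h.col _ _ h1.2.1

theorem entryAt_le_nextCellL (h : StdOn T a b) (p : ℕ × ℕ) :
    entryAt T p ≤ entryAt T (nextCellL T p) := by
  by_cases hn : nextCellL T p = p
  · rw [hn]
  · exact (h.entryAt_lt_nextCellL hn).le

theorem inShape_zero (h : StdOn T a b) (hab : a < b) : InShape T (0, 0) := by
  obtain ⟨p, hp, -⟩ := h.surj b hab le_rfl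
  exact (Nat.zero_le _).trans_lt (hp.trans_le (h.antitone_rowLen (Nat.zero_le p.1)))

theorem inShape_of_le (h : StdOn T a b) {i j i' j' : ℕ} (hi : i ≤ i') (hj : j ≤ j')
    (hp : InShape T (i', j')) : InShape T (i, j) :=
  hj.trans_lt (hp.trans_le (h.antitone_rowLen hi))

theorem entryAt_zero_le (h : StdOn T a b) (i j : ℕ) (hp : InShape T (i, j)) :
    entryAt T (0, 0) ≤ entryAt T (i, j) := by
  induction i with
  | zero =>
    induction j with
    | zero => exact le_rfl
    | succ j ih =>
      exact (ih (h.inShape_of_le le_rfl (Nat.le_succ j) hp)).trans (h.row _ _ hp).le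
  | succ i ih =>
    exact (ih (h.inShape_of_le (Nat.le_succ i) le_rfl hp)).trans (h.col _ _ hp).le

theorem entryAt_zero (h : StdOn T a b) (hab : a < b) : entryAt T (0, 0) = a + 1 := by
  obtain ⟨p, hp, he⟩ := h.surj (a + 1) (Nat.lt_succ_self a) hab
  have h1 := h.entryAt_zero_le p.1 p.2 hp
  have h2 := (h.mem _ (h.inShape_zero hab)).1
  have h3 : entryAt T (p.1, p.2) = a + 1 := he
  omega

theorem inShape_jdtPath (h : StdOn T a b) (hab : a < b) (k : ℕ) : InShape T (jdtPath T k) := by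
  induction k with
  | zero => exact h.inShape_zero hab
  | succ k ih => exact h.inShape_nextCellL ih

theorem monotone_entryAt_jdtPath (h : StdOn T a b) :
    Monotone fun k => entryAt T (jdtPath T k) :=
  monotone_nat_of_le_succ fun k => h.entryAt_le_nextCellL (jdtPath T k)

theorem jdtPath_eq_of_le {k l : ℕ} (hkl : k ≤ l)
    (hk : nextCellL T (jdtPath T k) = jdtPath T k) : jdtPath T l = jdtPath T k := by
  induction l, hkl using Nat.le_induction with
  | base => rfl
  | succ l _ ih => rw [jdtPath, ih, hk]

theorem nextCellL_vacated (h : StdOn T a b) (hab : a < b) :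
    nextCellL T (vacated T) = vacated T := by
  by_contra hne
  have hlt : ∀ k ≤ T.flatten.length, a + 1 + k ≤ entryAt T (jdtPath T k) := by
    intro k
    induction k with
    | zero => intro _; exact (h.entryAt_zero hab).ge
    | succ k ih =>
      intro hk
      have h1 := ih (by omega)
      have h2 : nextCellL T (jdtPath T k) ≠ jdtPath T k := fun he => by
        have e1 := jdtPath_eq_of_le (by omega : k ≤ T.flatten.length) he
        exact hne (by rw [vacated, e1, he])
      have h3 : entryAt T (jdtPath T k) < entryAt T (jdtPath T (k + 1)) :=
        h.entryAt_lt_nextCellL h2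
      omega
  have h1 := hlt _ le_rfl
  have h2 := (h.mem _ (h.inShape_jdtPath hab T.flatten.length)).2
  have := h.size
  omega

theorem inShape_vacated (h : StdOn T a b) (hab : a < b) : InShape T (vacated T) :=
  h.inShape_jdtPath hab _

theorem vacated_corner (h : StdOn T a b) (hab : a < b) :
    (vacated T).2 + 1 = rowLen T (vacated T).1 ∧
      rowLen T ((vacated T).1 + 1) ≤ (vacated T).2 := by
  have hm : (vacated T).2 < rowLen T (vacated T).1 := h.inShape_vacated hab
  have hn : nextCellL T ((vacated T).1, (vacated T).2) = ((vacated T).1, (vacated T).2) :=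
    h.nextCellL_vacated hab
  rcases h.nextCellL_cases (vacated T).1 (vacated T).2 with h1 | h1 | h1
  · have h2 := h1.2.1
    have h3 := h1.2.2
    simp only [InShape] at h2 h3
    omega
  · rw [hn] at h1
    have h2 := congrArg Prod.snd h1.1
    simp at h2
  · rw [hn] at h1
    have h2 := congrArg Prod.fst h1.1
    simp at h2

theorem eq_vacated (h : StdOn T a b) (hab : a < b) {k : ℕ}
    (hk : nextCellL T (jdtPath T k) = jdtPath T k) : jdtPath T k = vacated T := by
  rcases le_total k T.flatten.length with hl | hl
  · exact (jdtPath_eq_of_le hl hk).symm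
  · exact jdtPath_eq_of_le hl (h.nextCellL_vacated hab)

theorem slidValue_of_path (h : StdOn T a b) (hab : a < b) {k : ℕ}
    (hk : nextCellL T (jdtPath T k) ≠ jdtPath T k) :
    slidValue T (jdtPath T k).1 (jdtPath T k).2 = entryAt T (nextCellL T (jdtPath T k)) := by
  have hlt : k < T.flatten.length := by
    by_contra hl
    rw [jdtPath_eq_of_le (not_lt.1 hl) (h.nextCellL_vacated hab)] at hk
    exact hk (h.nextCellL_vacated hab)
  unfold slidValue
  split
  · next l hl =>
    have h1 := List.find?_some hl
    simp only [decide_eq_true_eq] at h1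
    rw [jdtPath, h1.1]; rfl
  · next hl =>
    rw [List.find?_eq_none] at hl
    exact absurd (by simpa [jdtPath] using hk) (hl k (List.mem_range.2 hlt))

theorem slidValue_of_not_path {p : ℕ × ℕ} (hp : ∀ k, jdtPath T k ≠ p) :
    slidValue T p.1 p.2 = entryAt T p := by
  unfold slidValue
  split
  · next l hl =>
    have h1 := List.find?_some hl
    simp only [decide_eq_true_eq] at h1
    exact absurd h1.1 (hp l)
  · rfl

end StdOn

theorem getD_filter_ne_nil (l : List (List ℕ)) (i : ℕ)
    (hl : ∀ i, l.getD i [] = [] → l.getD (i + 1) [] = []) :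
    (l.filter fun row => decide (row ≠ [])).getD i [] = l.getD i [] := by
  induction l generalizing i with
  | nil => simp
  | cons x l ih =>
    have hl' : ∀ i, l.getD i [] = [] → l.getD (i + 1) [] = [] := fun i => by
      simpa using hl (i + 1)
    by_cases hx : x = []
    · have hall : ∀ i, (x :: l).getD i [] = [] := fun i => by
        induction i with
        | zero => simpa using hx
        | succ i ihi => exact hl i ihi
      have hl0 : ∀ i, l.getD i [] = [] := fun i => by simpa using hall (i + 1)
      rw [hall i, List.filter_cons_of_neg (by simpa using hx), ih i hl', hl0]
    · rw [List.filter_cons_of_pos (by simpa using hx)]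
      cases i with
      | zero => rfl
      | succ i => simpa using ih i hl'

theorem getD_map_range {α : Type*} (n : ℕ) (f : ℕ → α) (d : α) (i : ℕ) :
    ((List.range n).map f).getD i d = if i < n then f i else d := by
  split_ifs with h
  · simp [List.getD, h]
  · simp [List.getD, h]

namespace StdOn

variable {T : List (List ℕ)} {a b : ℕ}

theorem getD_delta (h : StdOn T a b) (hab : a < b) (i : ℕ) :
    (delta T).getD i [] =
      (List.range (rowLen T i - if i = (vacated T).1 then 1 else 0)).map (slidValue T i) := by
  have hc := h.vacated_corner hab
  have hraw : ∀ i, (((List.range T.length).map fun i =>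
      (List.range ((T.getD i []).length - if i = (vacated T).1 then 1 else 0)).map fun j =>
        slidValue T i j)).getD i [] =
      (List.range (rowLen T i - if i = (vacated T).1 then 1 else 0)).map (slidValue T i) := by
    intro i
    rw [getD_map_range]
    by_cases h1 : i < T.length
    · rw [if_pos h1]; rfl
    · rw [if_neg h1, rowLen, List.getD_eq_default _ _ (not_lt.1 h1)]; simp
  rw [delta, getD_filter_ne_nil, hraw]
  intro i
  rw [hraw, hraw, List.map_eq_nil_iff, List.map_eq_nil_iff, List.range_eq_nil,
    List.range_eq_nil]
  have h1 := h.anti i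
  split_ifs with h2 h3 <;> intro h4 <;> subst_vars <;> omega

theorem rowLen_delta (h : StdOn T a b) (hab : a < b) (i : ℕ) :
    rowLen (delta T) i = rowLen T i - if i = (vacated T).1 then 1 else 0 := by
  rw [rowLen, h.getD_delta hab, List.length_map, List.length_range]

theorem inShape_delta (h : StdOn T a b) (hab : a < b) (p : ℕ × ℕ) :
    InShape (delta T) p ↔ InShape T p ∧ p ≠ vacated T := by
  have hc := h.vacated_corner hab
  rw [InShape, InShape, h.rowLen_delta hab, ne_eq, Prod.ext_iff]
  split_ifs with h1
  · rw [h1]; omega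
  · simp [h1]

theorem entryAt_delta (h : StdOn T a b) (hab : a < b) {p : ℕ × ℕ}
    (hp : InShape (delta T) p) : entryAt (delta T) p = slidValue T p.1 p.2 := by
  have h1 : p.2 < rowLen T p.1 - if p.1 = (vacated T).1 then 1 else 0 := by
    rw [← h.rowLen_delta hab]; exact hp
  rw [entryAt, entryL, h.getD_delta hab, getD_map_range, if_pos h1]

theorem entryAt_delta_jdtPath (h : StdOn T a b) (hab : a < b) {k : ℕ}
    (hk : InShape (delta T) (jdtPath T k)) :
    nextCellL T (jdtPath T k) ≠ jdtPath T k ∧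
      entryAt (delta T) (jdtPath T k) = entryAt T (nextCellL T (jdtPath T k)) := by
  have hne : nextCellL T (jdtPath T k) ≠ jdtPath T k := fun he =>
    ((h.inShape_delta hab _).1 hk).2 (h.eq_vacated hab he)
  exact ⟨hne, by rw [h.entryAt_delta hab hk, h.slidValue_of_path hab hne]⟩

theorem entryAt_lt_delta_jdtPath (h : StdOn T a b) (hab : a < b) {k : ℕ}
    (hk : InShape (delta T) (jdtPath T k)) :
    entryAt T (jdtPath T k) < entryAt (delta T) (jdtPath T k) := by
  have h1 := h.entryAt_delta_jdtPath hab hk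
  rw [h1.2]
  exact h.entryAt_lt_nextCellL h1.1

theorem entryAt_delta_of_not_path (h : StdOn T a b) (hab : a < b) {p : ℕ × ℕ}
    (hk : InShape (delta T) p) (hp : ∀ k, jdtPath T k ≠ p) :
    entryAt (delta T) p = entryAt T p := by
  rw [h.entryAt_delta hab hk, slidValue_of_not_path hp]

theorem entryAt_le_delta (h : StdOn T a b) (hab : a < b) {p : ℕ × ℕ}
    (hk : InShape (delta T) p) : entryAt T p ≤ entryAt (delta T) p := by
  by_cases hp : ∃ k, jdtPath T k = p
  · obtain ⟨k, rfl⟩ := hp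
    rw [(h.entryAt_delta_jdtPath hab hk).2]
    exact h.entryAt_le_nextCellL _
  · rw [h.entryAt_delta_of_not_path hab hk (not_exists.1 hp)]

/-- The slid entry at a cell, together with the cell it came from. -/
theorem entryAt_delta_cases (h : StdOn T a b) (hab : a < b) {p : ℕ × ℕ}
    (hk : InShape (delta T) p) :
    ((∀ k, jdtPath T k ≠ p) ∧ entryAt (delta T) p = entryAt T p) ∨
    ∃ k, jdtPath T k = p ∧ jdtPath T (k + 1) ≠ p ∧
      entryAt (delta T) p = entryAt T (jdtPath T (k + 1)) := by
  by_cases hp : ∃ k, jdtPath T k = p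
  · obtain ⟨k, rfl⟩ := hp
    exact Or.inr ⟨k, rfl, h.entryAt_delta_jdtPath hab hk⟩
  · exact Or.inl ⟨not_exists.1 hp, h.entryAt_delta_of_not_path hab hk (not_exists.1 hp)⟩

theorem jdtPath_lt_of_entryAt_lt (h : StdOn T a b) {k l : ℕ}
    (hkl : entryAt T (jdtPath T k) < entryAt T (jdtPath T l)) : k < l :=
  h.monotone_entryAt_jdtPath.reflect_lt hkl

theorem length_flatten_delta (h : StdOn T a b) (hab : a < b) :
    (delta T).flatten.length = b - (a + 1) := by
  have hc := h.vacated_corner hab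
  have hv : (vacated T).1 < T.length := by
    by_contra hv
    have h0 : rowLen T (vacated T).1 = 0 := by
      rw [rowLen, List.getD_eq_default _ _ (not_lt.1 hv)]; rfl
    omega
  have hT : T.flatten.length = ∑ i ∈ Finset.range T.length, rowLen T i := by
    have hmap : T.map List.length = (List.range T.length).map (rowLen T) :=
      List.ext_getElem (by simp) fun i h1 h2 => by
        have h3 : i < T.length := by simpa using h1
        simp [rowLen, List.getD, h3]
    rw [List.length_flatten, hmap]; rfl
  have hD : (delta T).flatten.length = ∑ i ∈ Finset.range T.length,
      (rowLen T i - if i = (vacated T).1 then 1 else 0) := by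
    rw [delta, List.flatten_filter_ne_nil, List.length_flatten, List.map_map]
    exact congrArg List.sum (List.map_congr_left fun i _ => by simp [rowLen])
  have hs := h.size
  rw [← Finset.add_sum_erase _ _ (Finset.mem_range.2 hv)] at hT hD
  rw [Finset.sum_congr rfl (fun i hi => by
    rw [if_neg (Finset.ne_of_mem_erase hi), Nat.sub_zero]), if_pos rfl] at hD
  rw [hs] at hT
  change _ = _ + ∑ i ∈ (Finset.range T.length).erase (vacated T).1, rowLen T i at hD
  omega

theorem delta (h : StdOn T a b) (hab : a < b) : StdOn (delta T) (a + 1) b where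
  anti i := by
    have hc := h.vacated_corner hab
    have h1 := h.anti i
    rw [h.rowLen_delta hab, h.rowLen_delta hab]
    split_ifs with h2 h3 h3 <;> subst_vars <;> omega
  row i j hj := by
    have hj' := ((h.inShape_delta hab _).1 hj).1
    have hi : InShape (PromRS.delta T) (i, j) := (Nat.lt_succ_self j).trans hj
    have hle := h.entryAt_le_delta hab hj
    rcases h.entryAt_delta_cases hab hi with h1 | ⟨k, h1, h2, h3⟩
    · rw [h1.2]; exact (h.row _ _ hj').trans_le hle
    · rw [jdtPath, h1] at h2 h3
      rw [h3]
      rcases h.nextCellL_cases i j with h4 | h4 | h4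
      · exact absurd h4.1 h2
      · have hk1 : jdtPath T (k + 1) = (i, j + 1) := by rw [jdtPath, h1, h4.1]
        rw [h4.1]
        rw [← hk1] at hj ⊢
        exact h.entryAt_lt_delta_jdtPath hab hj
      · rw [h4.1]
        exact (h4.2.2 hj').trans_le hle
  col i j hj := by
    have hj' := ((h.inShape_delta hab _).1 hj).1
    have hi : InShape (PromRS.delta T) (i, j) := by
      refine (h.inShape_delta hab _).2 ⟨h.inShape_of_le (Nat.le_succ i) le_rfl hj', fun hv => ?_⟩
      have hc := (h.vacated_corner hab).2
      rw [← hv] at hc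
      exact absurd hj' (not_lt.2 hc)
    have hle := h.entryAt_le_delta hab hj
    rcases h.entryAt_delta_cases hab hi with h1 | ⟨k, h1, h2, h3⟩
    · rw [h1.2]; exact (h.col _ _ hj').trans_le hle
    · rw [jdtPath, h1] at h2 h3
      rw [h3]
      rcases h.nextCellL_cases i j with h4 | h4 | h4
      · exact absurd h4.1 h2
      · rw [h4.1]
        exact (h4.2.2 hj').trans_le hle
      · have hk1 : jdtPath T (k + 1) = (i + 1, j) := by rw [jdtPath, h1, h4.1]
        rw [h4.1]
        rw [← hk1] at hj ⊢
        exact h.entryAt_lt_delta_jdtPath hab hj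
  mem p hp := by
    have h0 := (h.inShape_delta hab p).1 hp
    rcases h.entryAt_delta_cases hab hp with h1 | ⟨k, h1, h2, h3⟩
    · rw [h1.2]
      have h2 := h.mem p h0.1
      refine ⟨lt_of_le_of_ne h2.1 fun he => h1.1 0 ?_, h2.2⟩
      exact h.inj _ _ (h.inShape_zero hab) h0.1 ((h.entryAt_zero hab).trans he)
    · rw [h3]
      refine ⟨?_, (h.mem _ (h.inShape_jdtPath hab _)).2⟩
      rw [← h.entryAt_zero hab]
      refine (h.entryAt_zero_le _ _ h0.1).trans_lt ?_
      have := h.entryAt_lt_nextCellL (p := jdtPath T k) (by rw [h1]; rw [jdtPath, h1] at h2; exact h2)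
      rw [← h1]; exact this
  surj m h1 h2 := by
    obtain ⟨p, hp, he⟩ := h.surj m (by omega) h2
    by_cases hk : ∃ k, jdtPath T k = p
    · have hf := Nat.find_spec hk
      cases hn : Nat.find hk with
      | zero =>
        rw [hn] at hf
        have := h.entryAt_zero hab
        rw [jdtPath] at hf
        rw [hf] at this
        omega
      | succ k =>
        rw [hn] at hf
        have hk' : jdtPath T k ≠ p := Nat.find_min hk (by omega)
        have hs : InShape (PromRS.delta T) (jdtPath T k) := by
          refine (h.inShape_delta hab _).2 ⟨h.inShape_jdtPath hab k, fun hv => hk' ?_⟩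
          rw [← hf, jdtPath, hv, h.nextCellL_vacated hab]
        refine ⟨_, hs, ?_⟩
        rw [(h.entryAt_delta_jdtPath hab hs).2, ← he, ← hf]; rfl
    · have hs : InShape (PromRS.delta T) p :=
        (h.inShape_delta hab p).2 ⟨hp, fun hv => hk ⟨_, hv.symm⟩⟩
      exact ⟨p, hs, by rw [h.entryAt_delta_of_not_path hab hs (not_exists.1 hk), he]⟩
  inj p q hp hq he := by
    have hp0 := ((h.inShape_delta hab p).1 hp).1
    have hq0 := ((h.inShape_delta hab q).1 hq).1
    rcases h.entryAt_delta_cases hab hp with h1 | ⟨k, h1, h2, h3⟩ <;>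
      rcases h.entryAt_delta_cases hab hq with h4 | ⟨l, h4, h5, h6⟩
    · exact h.inj _ _ hp0 hq0 (by rw [← h1.2, ← h4.2, he])
    · exact absurd (h.inj _ _ (h.inShape_jdtPath hab _) hp0 (by rw [← h1.2, ← h6, he]))
        (h1.1 _)
    · exact absurd (h.inj _ _ (h.inShape_jdtPath hab _) hq0 (by rw [← h4.2, ← h3, he]))
        (h4.1 _)
    · have hk : entryAt T (jdtPath T k) < entryAt T (jdtPath T (k + 1)) :=
        h.entryAt_lt_nextCellL (by rw [h1]; rw [jdtPath, h1] at h2; exact h2)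
      have hl : entryAt T (jdtPath T l) < entryAt T (jdtPath T (l + 1)) :=
        h.entryAt_lt_nextCellL (by rw [h4]; rw [jdtPath, h4] at h5; exact h5)
      have h7 : k < l + 1 := h.jdtPath_lt_of_entryAt_lt (by rw [← h6, ← he, h3]; exact hk)
      have h8 : l < k + 1 := h.jdtPath_lt_of_entryAt_lt (by rw [← h3, he, h6]; exact hl)
      have h9 : k = l := by omega
      rw [← h1, ← h4, h9]
  size := h.length_flatten_delta hab

end StdOn

theorem lt_card_filter_range_iff {p : ℕ → Prop} [DecidablePred p] {n : ℕ}
    (hp : ∀ k, k + 1 < n → p (k + 1) → p k) (k : ℕ) :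
    k < ((Finset.range n).filter p).card ↔ k < n ∧ p k := by
  induction n with
  | zero => simp
  | succ n ih =>
    have ih' := ih fun k hk => hp k (by omega)
    have hdown : ∀ d m, m + d ≤ n → p (m + d) → p m := by
      intro d
      induction d with
      | zero => exact fun m _ h => h
      | succ d ihd => exact fun m hm h => ihd m (by omega) (hp _ (by omega) h)
    rw [Finset.range_add_one, Finset.filter_insert]
    split_ifs with hn
    · have hall : (Finset.range n).filter p = Finset.range n :=
        Finset.filter_true_of_mem fun m hm => by
          have hm := Finset.mem_range.1 hm
          exact hdown (n - m) m (by omega) (by rwa [Nat.add_sub_cancel' hm.le])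
      rw [Finset.card_insert_of_notMem (by simp), hall, Finset.card_range]
      refine ⟨fun h => ⟨h, hdown (n - k) k (by omega) ?_⟩, fun h => h.1⟩
      rwa [Nat.add_sub_cancel' (by omega)]
    · rw [ih']
      refine ⟨fun h => ⟨by omega, h.2⟩, fun h => ⟨lt_of_le_of_ne (by omega) ?_, h.2⟩⟩
      rintro rfl
      exact hn h.2

theorem sortDesc_eq_of_perm {l m : List ℕ} (hp : l.Perm m) (hm : m.Pairwise (· ≥ ·)) :
    sortDesc l = m :=
  ((List.perm_insertionSort _ l).trans hp).eq_of_pairwise' (List.pairwise_insertionSort _ l) hm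

theorem ruleSeq_map_range (R : ℕ) (lam nu ka : ℕ → ℕ) :
    ruleSeq ((List.range R).map lam) ((List.range R).map nu) ((List.range R).map ka) =
      (List.range R).map fun i => nu i + ka i - lam i := by
  simp [ruleSeq, List.zipWith_map, List.zipWith_self]

theorem pairwise_map_range {R : ℕ} {f : ℕ → ℕ} (hf : Antitone f) :
    ((List.range R).map f).Pairwise (· ≥ ·) :=
  List.pairwise_map.2 (List.pairwise_lt_range.imp fun h => hf h.le)

/-- The local rule when `ν + κ - λ` is already sorted. -/
theorem localRule_of_add_eq {R : ℕ} {lam nu ka mu : ℕ → ℕ} (hmu : Antitone mu)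
    (h : ∀ i, nu i + ka i = mu i + lam i) :
    localRule ((List.range R).map lam) ((List.range R).map nu) ((List.range R).map ka) =
      (List.range R).map mu := by
  rw [localRule, ruleSeq_map_range]
  refine sortDesc_eq_of_perm (List.Perm.of_eq ?_) (pairwise_map_range hmu)
  exact List.map_congr_left fun i _ => by rw [h]; omega

/-- The local rule when `ν + κ - λ` becomes sorted after exchanging rows `i` and `i + 1`. -/
theorem localRule_of_swap {R : ℕ} {lam nu ka : ℕ → ℕ} (hlam : Antitone lam) {i : ℕ}
    (hi : i + 1 < R) (h0 : lam (i + 1) + 1 = lam i) (h1 : nu i + ka i + 1 = 2 * lam i)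
    (h2 : nu (i + 1) + ka (i + 1) = 2 * lam (i + 1) + 1)
    (h : ∀ k, k ≠ i → k ≠ i + 1 → nu k + ka k = 2 * lam k) :
    localRule ((List.range R).map lam) ((List.range R).map nu) ((List.range R).map ka) =
      (List.range R).map lam := by
  rw [localRule, ruleSeq_map_range]
  refine sortDesc_eq_of_perm ?_ (pairwise_map_range hlam)
  have hs : (List.range R).map (fun k => nu k + ka k - lam k) =
      ((List.range R).map (Equiv.swap i (i + 1))).map lam := by
    rw [List.map_map]
    refine List.map_congr_left fun k _ => ?_
    rw [Function.comp_apply, Equiv.swap_apply_def]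
    split_ifs with h3 h4
    · subst h3; omega
    · subst h4; omega
    · rw [h k h3 h4]; omega
  rw [hs]
  refine List.Perm.map _ ((List.perm_ext_iff_of_nodup
    (List.nodup_range.map (Equiv.injective _)) List.nodup_range).2 fun k => ?_)
  simp only [List.mem_map, List.mem_range]
  constructor
  · rintro ⟨m, hm, rfl⟩
    rw [Equiv.swap_apply_def]
    split_ifs <;> omega
  · intro hk
    refine ⟨Equiv.swap i (i + 1) k, ?_, Equiv.swap_apply_self _ _ _⟩
    rw [Equiv.swap_apply_def]
    split_ifs <;> omega

/-- Number of entries at most `x` in the `i`-th row of `T`. -/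
def chainRow (T : List (List ℕ)) (x i : ℕ) : ℕ :=
  ((Finset.range (rowLen T i)).filter fun j => entryAt T (i, j) ≤ x).card

namespace StdOn

variable {T : List (List ℕ)} {a b : ℕ}

theorem lt_chainRow (h : StdOn T a b) (x : ℕ) (p : ℕ × ℕ) :
    p.2 < chainRow T x p.1 ↔ InShape T p ∧ entryAt T p ≤ x :=
  lt_card_filter_range_iff (p := fun j => entryAt T (p.1, j) ≤ x)
    (fun _ hj hx => (h.row _ _ hj).le.trans hx) p.2

theorem antitone_chainRow (h : StdOn T a b) (x : ℕ) : Antitone (chainRow T x) := by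
  refine antitone_nat_of_succ_le fun i => le_of_forall_lt fun j hj => ?_
  obtain ⟨h1, h2⟩ := (h.lt_chainRow x (i + 1, j)).1 hj
  exact (h.lt_chainRow x (i, j)).2
    ⟨h.inShape_of_le (Nat.le_succ i) le_rfl h1, (h.col _ _ h1).le.trans h2⟩

theorem chainRow_of_le (h : StdOn T a b) {x : ℕ} (hx : x ≤ a) (i : ℕ) : chainRow T x i = 0 := by
  by_contra h0
  obtain ⟨h1, h2⟩ := (h.lt_chainRow x (i, 0)).1 (Nat.pos_of_ne_zero h0)
  exact absurd (h.mem _ h1).1 (by omega)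

theorem chainRow_of_ge (h : StdOn T a b) {x : ℕ} (hx : b ≤ x) (i : ℕ) :
    chainRow T x i = rowLen T i := by
  refine eq_of_forall_lt_iff fun j => ?_
  rw [h.lt_chainRow x (i, j)]
  exact ⟨fun h1 => h1.1, fun h1 => ⟨h1, (h.mem (i, j) h1).2.trans hx⟩⟩

theorem chainRow_succ (h : StdOn T a b) {x : ℕ} {p : ℕ × ℕ} (hp : InShape T p)
    (hpx : entryAt T p = x + 1) (i : ℕ) :
    chainRow T (x + 1) i = chainRow T x i + if i = p.1 then 1 else 0 := by
  have key : ∀ j, j < chainRow T (x + 1) i ↔ j < chainRow T x i ∨ (i, j) = p := fun j => by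
    rw [h.lt_chainRow (x + 1) (i, j), h.lt_chainRow x (i, j)]
    constructor
    · rintro ⟨h1, h2⟩
      by_cases h3 : entryAt T (i, j) = x + 1
      · exact Or.inr (h.inj _ _ h1 hp (by rw [h3, hpx]))
      · exact Or.inl ⟨h1, by omega⟩
    · rintro (h1 | rfl)
      · exact ⟨h1.1, by omega⟩
      · exact ⟨hp, hpx.le⟩
  split_ifs with hi
  · subst hi
    have hn : ¬ p.2 < chainRow T x p.1 := fun h1 => by
      have := ((h.lt_chainRow x p).1 h1).2
      omega
    have h1 : p.2 < chainRow T (x + 1) p.1 := (key p.2).2 (Or.inr rfl)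
    have h2 : ∀ j, j < chainRow T (x + 1) p.1 → j < chainRow T x p.1 ∨ j = p.2 := fun j hj =>
      ((key j).1 hj).imp id fun h3 => congrArg Prod.snd h3
    have h4 := (key (chainRow T x p.1)).1
    have h5 := h2 (chainRow T (x + 1) p.1 - 1) (by omega)
    have h6 := fun h => (key (p.2 - 1)).2 (Or.inl h)
    have h7 := h2 (p.2 - 1) (by omega)
    omega
  · refine eq_of_forall_lt_iff fun j => (key j).trans ?_
    refine or_iff_left fun h1 => hi (congrArg Prod.fst h1)

/-- `k` is the last step of the sliding path whose entry is at most `x`. -/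
def IsLastStep (T : List (List ℕ)) (x k : ℕ) : Prop :=
  entryAt T (jdtPath T k) ≤ x ∧
    (nextCellL T (jdtPath T k) = jdtPath T k ∨ x < entryAt T (nextCellL T (jdtPath T k)))

theorem exists_isLastStep (h : StdOn T a b) (hab : a < b) {x : ℕ} (hx : a + 1 ≤ x) :
    ∃ k, IsLastStep T x k := by
  by_contra! hno
  have hall : ∀ k, entryAt T (jdtPath T k) ≤ x := fun k => by
    induction k with
    | zero => exact (h.entryAt_zero hab).trans_le hx
    | succ k ih =>
      by_contra hk
      exact hno k ⟨ih, Or.inr (not_le.1 hk)⟩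
  exact hno T.flatten.length ⟨hall _, Or.inl (h.nextCellL_vacated hab)⟩

theorem lt_chainRow_delta (h : StdOn T a b) (hab : a < b) {x k : ℕ}
    (hk : IsLastStep T x k) (p : ℕ × ℕ) :
    p.2 < chainRow (PromRS.delta T) x p.1 ↔ p.2 < chainRow T x p.1 ∧ p ≠ jdtPath T k := by
  rw [(h.delta hab).lt_chainRow, h.lt_chainRow]
  constructor
  · rintro ⟨h1, h2⟩
    refine ⟨⟨((h.inShape_delta hab p).1 h1).1, (h.entryAt_le_delta hab h1).trans h2⟩, ?_⟩
    rintro rfl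
    have h3 := h.entryAt_delta_jdtPath hab h1
    rcases hk.2 with h4 | h4
    · exact h3.1 h4
    · omega
  · rintro ⟨⟨h1, h2⟩, h3⟩
    by_cases hp : ∃ l, jdtPath T l = p
    · obtain ⟨l, rfl⟩ := hp
      have hlk : l < k := by
        by_contra hkl
        have hkl : k < l := lt_of_le_of_ne (not_lt.1 hkl) (by rintro rfl; exact h3 rfl)
        rcases hk.2 with h4 | h4
        · exact h3 (jdtPath_eq_of_le hkl.le h4)
        · exact absurd (h4.trans_le (h.monotone_entryAt_jdtPath hkl)) (not_lt.2 h2)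
      have hs : InShape (PromRS.delta T) (jdtPath T l) := by
        refine (h.inShape_delta hab _).2 ⟨h1, fun hv => h3 ?_⟩
        refine (jdtPath_eq_of_le hlk.le ?_).symm
        rw [hv, h.nextCellL_vacated hab]
      refine ⟨hs, ?_⟩
      rw [(h.entryAt_delta_jdtPath hab hs).2]
      exact (h.monotone_entryAt_jdtPath hlk).trans hk.1
    · have hs : InShape (PromRS.delta T) p :=
        (h.inShape_delta hab p).2 ⟨h1, fun hv => hp ⟨_, hv.symm⟩⟩
      exact ⟨hs, by rwa [h.entryAt_delta_of_not_path hab hs (not_exists.1 hp)]⟩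

theorem chainRow_delta (h : StdOn T a b) (hab : a < b) {x k : ℕ} (hk : IsLastStep T x k) :
    chainRow T x (jdtPath T k).1 = (jdtPath T k).2 + 1 ∧
    ∀ i, chainRow (PromRS.delta T) x i + (if i = (jdtPath T k).1 then 1 else 0) =
      chainRow T x i := by
  set q := jdtPath T k with hq
  have hqs : q.2 < chainRow T x q.1 := (h.lt_chainRow x q).2 ⟨h.inShape_jdtPath hab k, hk.1⟩
  have key := fun i j => h.lt_chainRow_delta hab hk (i, j)
  simp only [← hq, ne_eq, Prod.ext_iff] at key
  have hqn : chainRow T x q.1 = q.2 + 1 := by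
    by_contra hne
    have h1 := (key q.1 (q.2 + 1)).2 ⟨by omega, by simp⟩
    exact ((key q.1 q.2).1 (by omega)).2 ⟨rfl, rfl⟩
  refine ⟨hqn, fun i => ?_⟩
  split_ifs with hi
  · subst hi
    have h1 := key q.1 q.2
    have h2 := key q.1 (q.2 - 1)
    simp only [true_and, not_true_eq_false, and_false, iff_false] at h1 h2
    omega
  · exact eq_of_forall_lt_iff fun j => by simp [key i j, hi]

/-- The chains of `T` and of its rectified deletion are related by the local rule. -/
theorem localRule_chainRow (h : StdOn T a b) (hab : a < b) {R x : ℕ} (hR : rowLen T R = 0)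
    (hax : a + 1 ≤ x) (hxb : x + 1 ≤ b) :
    localRule ((List.range R).map (chainRow T x)) ((List.range R).map (chainRow T (x + 1)))
      ((List.range R).map (chainRow (PromRS.delta T) x)) =
      (List.range R).map (chainRow (PromRS.delta T) (x + 1)) := by
  obtain ⟨k, hk⟩ := h.exists_isLastStep hab hax
  obtain ⟨p, hp, hpx⟩ := h.surj (x + 1) (by omega) hxb
  have hC := h.chainRow_delta hab hk
  have hS := h.chainRow_succ hp hpx
  by_cases hpn : nextCellL T (jdtPath T k) = p
  · have hne : nextCellL T (jdtPath T k) ≠ jdtPath T k := fun he => by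
      have := hk.1
      rw [← he, hpn] at this
      omega
    have hk' : IsLastStep T (x + 1) (k + 1) := by
      have hpk : jdtPath T (k + 1) = p := hpn
      refine ⟨by rw [hpk, hpx], ?_⟩
      rw [hpk]
      by_cases h1 : nextCellL T p = p
      · exact Or.inl h1
      · exact Or.inr (by rw [← hpx]; exact h.entryAt_lt_nextCellL h1)
    have hC' := (h.chainRow_delta hab hk').2
    have hpk : jdtPath T (k + 1) = p := hpn
    rw [hpk] at hC'
    have hmu : chainRow (PromRS.delta T) (x + 1) = chainRow T x := funext fun i => by
      have h1 := hC' i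
      have h2 := hS i
      omega
    rw [hmu]
    obtain ⟨i, j⟩ := p
    have hcase := h.nextCellL_cases (jdtPath T k).1 (jdtPath T k).2
    rcases hcase with h1 | h1 | h1
    · exact absurd h1.1 hne
    · have hpi : i = (jdtPath T k).1 := by
        have := hpn.symm.trans h1.1
        simpa using congrArg Prod.fst this
      refine localRule_of_add_eq (h.antitone_chainRow x) fun l => ?_
      have h2 := hS l
      have h3 := hC.2 l
      simp only [hpi] at h2
      omega
    · have hpq : (i, j) = ((jdtPath T k).1 + 1, (jdtPath T k).2) := hpn.symm.trans h1.1
      have hpi : i = (jdtPath T k).1 + 1 := congrArg Prod.fst hpq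
      have hpj : j = (jdtPath T k).2 := congrArg Prod.snd hpq
      have hiR : i < R := by
        by_contra hiR
        have h2 : j < rowLen T i := hp
        have h3 := h.antitone_rowLen (not_lt.1 hiR)
        omega
      have hnu : j < chainRow T (x + 1) i :=
        (h.lt_chainRow (x + 1) (i, j)).2 ⟨hp, hpx.le⟩
      have hlam : ¬ j < chainRow T x i := fun h2 => by
        have := ((h.lt_chainRow x (i, j)).1 h2).2
        omega
      have hSi := hS i
      have hSq := hS (jdtPath T k).1
      have hCi := hC.2 i
      have hCq := hC.2 (jdtPath T k).1
      have hC1 := hC.1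
      simp only [if_true] at hSi hCq
      rw [if_neg (show ¬ (jdtPath T k).1 = i by omega)] at hSq
      rw [if_neg (show ¬ i = (jdtPath T k).1 by omega)] at hCi
      subst hpi
      refine localRule_of_swap (h.antitone_chainRow x) (i := (jdtPath T k).1) hiR
        (by omega) (by omega) (by omega) fun l hl1 hl2 => ?_
      have h2 := hS l
      have h3 := hC.2 l
      rw [if_neg (by assumption)] at h2 h3
      omega
  · have hk' : IsLastStep T (x + 1) k := by
      refine ⟨hk.1.trans (Nat.le_succ x), hk.2.imp id fun h1 => ?_⟩
      refine lt_of_le_of_ne h1 fun h2 => hpn ?_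
      exact h.inj _ _ (h.inShape_nextCellL (h.inShape_jdtPath hab k)) hp (by rw [hpx, ← h2])
    have hC' := (h.chainRow_delta hab hk').2
    refine localRule_of_add_eq ((h.delta hab).antitone_chainRow (x + 1)) fun l => ?_
    have h1 := hC.2 l
    have h2 := hC' l
    omega

end StdOn

/-- The number of indices below `c` at which `f` exceeds `i`: the conjugate of the partition
with parts `f 0, …, f (c - 1)`. -/
def conj (c : ℕ) (f : ℕ → ℕ) (i : ℕ) : ℕ := ((Finset.range c).filter fun j => i < f j).card

theorem antitone_conj (c : ℕ) (f : ℕ → ℕ) : Antitone (conj c f) := fun _ _ h =>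
  Finset.card_le_card (Finset.monotone_filter_right _ fun _ _ hj => h.trans_lt hj)

theorem conj_le (c : ℕ) (f : ℕ → ℕ) (i : ℕ) : conj c f i ≤ c :=
  (Finset.card_filter_le _ _).trans_eq (Finset.card_range c)

theorem lt_conj_iff {c : ℕ} {f : ℕ → ℕ} (hf : Antitone f) {i j : ℕ} :
    j < conj c f i ↔ j < c ∧ i < f j :=
  lt_card_filter_range_iff (fun k _ hk => hk.trans_le (hf (Nat.le_succ k))) j

theorem conj_conj {c R : ℕ} {f : ℕ → ℕ} (hf : Antitone f) (hR : f R = 0) (hc : ∀ i, f i ≤ c)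
    (i : ℕ) : conj c (conj R f) i = f i := by
  refine eq_of_forall_lt_iff fun j => ?_
  rw [lt_conj_iff (antitone_conj R f), lt_conj_iff hf]
  refine ⟨fun h => h.2.2, fun h => ⟨h.trans_le (hc i), ?_, h⟩⟩
  by_contra hi
  have := hf (not_lt.1 hi)
  omega

theorem conj_add_single {c a : ℕ} {f g : ℕ → ℕ} (ha : a < c)
    (h : ∀ j, g j = f j + if j = a then 1 else 0) (i : ℕ) :
    conj c g i = conj c f i + if i = f a then 1 else 0 := by
  have hs : (if i = f a then 1 else 0) =
      ∑ j ∈ Finset.range c, if j = a then (if i = f a then 1 else 0) else 0 := by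
    rw [Finset.sum_ite_eq' (Finset.range c) a, if_pos (Finset.mem_range.2 ha)]
  rw [conj, conj, Finset.card_filter, Finset.card_filter, hs, ← Finset.sum_add_distrib]
  refine Finset.sum_congr rfl fun j _ => ?_
  rw [h j]
  by_cases hj : j = a
  · subst hj
    simp only [if_true]
    split_ifs <;> omega
  · simp [hj]

/-- The local rule in terms of column heights: a cell is added to column `a'` along the top
and to column `a` (from bottom to top) along the left edge. -/
theorem localRule_conj {R c a a' : ℕ} {lam nu ka mu : ℕ → ℕ} (ha : a < c) (ha' : a' < c)
    (hnu : ∀ j, nu j = lam j + if j = a' then 1 else 0)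
    (hlam : ∀ j, lam j = ka j + if j = a then 1 else 0)
    (hmu : ∀ j, nu j = mu j + if j = a then 1 else 0)
    (hnu_anti : Antitone nu) (hka_anti : Antitone ka) (hR : ∀ j, nu j ≤ R) :
    localRule ((List.range R).map (conj c lam)) ((List.range R).map (conj c nu))
      ((List.range R).map (conj c ka)) = (List.range R).map (conj c mu) := by
  have h1 := conj_add_single ha' hnu
  have h2 := conj_add_single ha hlam
  have h3 := conj_add_single ha hmu
  have hla := hlam a
  rw [if_pos rfl] at hla
  by_cases haa : a = a'
  · subst haa
    have hmul : mu = lam := funext fun j => by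
      have := hnu j
      have := hmu j
      omega
    rw [hmul]
    have hna := hnu a
    rw [if_pos rfl] at hna
    have hlt : ∀ j < a, lam a < lam j := fun j hj => by
      have h4 := hnu j
      have h5 := hnu_anti hj.le
      rw [if_neg hj.ne] at h4
      omega
    have hgt : ∀ j, a < j → lam j ≤ ka a := fun j hj => by
      have h4 := hlam j
      have h5 := hka_anti hj.le
      rw [if_neg hj.ne'] at h4
      omega
    have hcount : ∀ t m, m ≤ c → (∀ j, t < lam j ↔ j < m) → conj c lam t = m :=
      fun t m hm ht => eq_of_forall_lt_iff fun j => by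
        rw [conj, lt_card_filter_range_iff (p := fun j => t < lam j) fun k _ hk => by
          rw [ht] at hk ⊢; omega]
        rw [ht]
        exact ⟨fun h => h.2, fun h => ⟨h.trans_le hm, h⟩⟩
    have hc1 : conj c lam (ka a + 1) = a := hcount _ _ ha.le fun j => by
      have := hlt j
      have := hgt j
      rcases lt_trichotomy j a with h4 | rfl | h4 <;> omega
    have hc0 : conj c lam (ka a) = a + 1 := hcount _ _ ha fun j => by
      have := hlt j
      have := hgt j
      rcases lt_trichotomy j a with h4 | rfl | h4 <;> omega
    have hRa := hR a
    rw [hla] at h1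
    refine localRule_of_swap (antitone_conj c lam) (i := ka a) (by omega) (by omega) ?_ ?_ ?_
    · have h4 := h1 (ka a)
      have h5 := h2 (ka a)
      rw [if_pos rfl] at h5
      rw [if_neg (by omega)] at h4
      omega
    · have h4 := h1 (ka a + 1)
      have h5 := h2 (ka a + 1)
      rw [if_pos rfl] at h4
      rw [if_neg (by omega)] at h5
      omega
    · intro k hk1 hk2
      have h4 := h1 k
      have h5 := h2 k
      rw [if_neg hk2] at h4
      rw [if_neg hk1] at h5
      omega
  · have hk : mu a = ka a := by
      have h4 := hnu a
      have h5 := hmu a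
      rw [if_neg haa] at h4
      rw [if_pos rfl] at h5
      omega
    refine localRule_of_add_eq (antitone_conj c mu) fun i => ?_
    rw [h3, h2, hk]
    omega

theorem rowLen_toListT (r c : ℕ) (P : ℕ → ℕ → ℕ) (i : ℕ) :
    rowLen (toListT r c P) i = if i < r then c else 0 := by
  rw [rowLen, toListT, getD_map_range]
  split_ifs <;> simp

theorem inShape_toListT {r c : ℕ} {P : ℕ → ℕ → ℕ} {p : ℕ × ℕ} :
    InShape (toListT r c P) p ↔ p.1 < r ∧ p.2 < c := by
  rw [InShape, rowLen_toListT]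
  split_ifs with h <;> simp [h]

theorem entryAt_toListT {r c : ℕ} {P : ℕ → ℕ → ℕ} {i j : ℕ} (hi : i < r) (hj : j < c) :
    entryAt (toListT r c P) (i, j) = P i j := by
  simp only [entryAt, entryL, toListT]
  rw [getD_map_range, if_pos hi, getD_map_range, if_pos hj]

theorem IsSYT.stdOn {r c : ℕ} {P : ℕ → ℕ → ℕ} (h : IsSYT r c P) :
    StdOn (toListT r c P) 0 (r * c) where
  anti i := by
    rw [rowLen_toListT, rowLen_toListT]
    split_ifs <;> omega
  row i j hj := by
    obtain ⟨h1, h2⟩ := inShape_toListT.1 hj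
    simp only at h1 h2
    rw [entryAt_toListT h1 h2, entryAt_toListT h1 (by omega)]
    exact h.1 i j h1 h2
  col i j hj := by
    obtain ⟨h1, h2⟩ := inShape_toListT.1 hj
    simp only at h1 h2
    rw [entryAt_toListT h1 h2, entryAt_toListT (by omega) h2]
    exact h.2.1 i j h1 h2
  mem p hp := by
    have h1 := inShape_toListT.1 hp
    rw [← Prod.mk.eta (p := p), entryAt_toListT h1.1 h1.2]
    exact h.2.2.mapsTo h1
  surj m h1 h2 := by
    obtain ⟨p, hp, he⟩ := h.2.2.surjOn ⟨h1, h2⟩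
    refine ⟨p, inShape_toListT.2 hp, ?_⟩
    rw [← Prod.mk.eta (p := p), entryAt_toListT hp.1 hp.2]
    exact he
  inj p q hp hq he := by
    have h1 := inShape_toListT.1 hp
    have h2 := inShape_toListT.1 hq
    rw [← Prod.mk.eta (p := p), ← Prod.mk.eta (p := q), entryAt_toListT h1.1 h1.2,
      entryAt_toListT h2.1 h2.2] at he
    exact h.2.2.injOn h1 h2 he
  size := by
    simp [toListT, List.length_flatten, Function.comp_def]

namespace StdOn

variable {T : List (List ℕ)} {n : ℕ}

theorem delta_iterate (h : StdOn T 0 n) {k : ℕ} (hk : k ≤ n) :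
    StdOn (PromRS.delta^[k] T) k n := by
  induction k with
  | zero => exact h
  | succ k ih =>
    rw [Function.iterate_succ_apply']
    exact (ih (by omega)).delta hk

theorem inShape_delta_iterate_succ (h : StdOn T 0 n) {k : ℕ} (hk : k < n) (p : ℕ × ℕ) :
    InShape (PromRS.delta^[k + 1] T) p ↔
      InShape (PromRS.delta^[k] T) p ∧ p ≠ vacated (PromRS.delta^[k] T) := by
  rw [Function.iterate_succ_apply']
  exact (h.delta_iterate hk.le).inShape_delta hk p

theorem inShape_delta_iterate_anti (h : StdOn T 0 n) {k l : ℕ} (hkl : k ≤ l) (hl : l ≤ n)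
    {p : ℕ × ℕ} (hp : InShape (PromRS.delta^[l] T) p) : InShape (PromRS.delta^[k] T) p := by
  induction l, hkl using Nat.le_induction with
  | base => exact hp
  | succ l _ ih => exact ih (by omega) ((h.inShape_delta_iterate_succ hl p).1 hp).1

theorem rowLen_delta_iterate_le (h : StdOn T 0 n) {k : ℕ} (hk : k ≤ n) (i : ℕ) :
    rowLen (PromRS.delta^[k] T) i ≤ rowLen T i :=
  le_of_forall_lt fun j hj =>
    h.inShape_delta_iterate_anti (Nat.zero_le k) hk (p := (i, j)) hj

theorem rowLen_self {T : List (List ℕ)} {n : ℕ} (h : StdOn T n n) (i : ℕ) : rowLen T i = 0 := by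
  by_contra h0
  have := h.mem (i, 0) (Nat.pos_of_ne_zero h0)
  omega

/-- The cells of `T` whose evacuation entry is at most `y` are the cells that survive `n - y`
deletions. -/
theorem evacEntry_le_iff (h : StdOn T 0 n) {y : ℕ} (hy : y ≤ n) {p : ℕ × ℕ}
    (hp : InShape T p) :
    evacEntry T p.1 p.2 ≤ y ↔ InShape (PromRS.delta^[n - y] T) p := by
  have hn : T.flatten.length = n := h.size
  unfold evacEntry
  split
  · next k hk =>
    rw [hn] at hk ⊢
    have hkn : k < n := List.mem_range.1 (List.mem_of_find?_eq_some hk)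
    have hv := List.find?_some hk
    rw [List.find?_range_eq_some] at hk
    have hbefore : ∀ l ≤ k, InShape (PromRS.delta^[l] T) p := by
      intro l
      induction l with
      | zero => exact fun _ => hp
      | succ l ih =>
        intro hl
        refine (h.inShape_delta_iterate_succ (by omega) p).2 ⟨ih (by omega), fun he => ?_⟩
        have := hk.2.2 l hl
        simp [← he] at this
    constructor
    · intro hle
      exact hbefore _ (by omega)
    · intro hs
      by_contra hlt
      have h1 := h.inShape_delta_iterate_anti (k := k + 1) (l := n - y) (by omega) (by omega) hs
      refine ((h.inShape_delta_iterate_succ hkn p).1 h1).2 ?_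
      simpa using (of_decide_eq_true hv).symm
  · next hnone =>
    rw [hn, List.find?_range_eq_none] at hnone
    have hall : ∀ l ≤ n, InShape (PromRS.delta^[l] T) p := by
      intro l
      induction l with
      | zero => exact fun _ => hp
      | succ l ih =>
        intro hl
        refine (h.inShape_delta_iterate_succ (by omega) p).2 ⟨ih (by omega), fun he => ?_⟩
        have := hnone l hl
        simp [← he] at this
    exact ⟨fun _ => hall _ (by omega), fun _ => Nat.zero_le y⟩

theorem chainRow_evacL (h : StdOn T 0 n) {y : ℕ} (hy : y ≤ n) (i : ℕ) :
    chainRow (evacL T) y i = rowLen (PromRS.delta^[n - y] T) i := by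
  have hrow : (evacL T).getD i [] = (List.range (rowLen T i)).map (evacEntry T i) := by
    rw [evacL, getD_map_range]
    split_ifs with hi
    · rfl
    · rw [rowLen, List.getD_eq_default _ _ (not_lt.1 hi)]; rfl
  have hle := h.rowLen_delta_iterate_le (Nat.sub_le n y) i
  have hlen : rowLen (evacL T) i = rowLen T i := by
    rw [rowLen, hrow, List.length_map, List.length_range]
  rw [chainRow, hlen, Finset.filter_congr (q := fun j => j < rowLen (PromRS.delta^[n - y] T) i)]
  · rw [← Finset.card_range (rowLen (PromRS.delta^[n - y] T) i)]
    congr 1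
    ext j
    simp only [Finset.mem_filter, Finset.mem_range, Finset.card_range]
    omega
  · intro j hj
    have hj' := Finset.mem_range.1 hj
    rw [entryAt, entryL, hrow, getD_map_range, if_pos hj']
    exact h.evacEntry_le_iff hy (p := (i, j)) hj'

end StdOn

theorem length_filter_eq_card (l : List ℕ) (p : ℕ → Prop) [DecidablePred p] :
    (l.filter fun a => decide (p a)).length =
      ((Finset.range l.length).filter fun j => p (l.getD j 0)).card := by
  have hl : l = (List.range l.length).map fun j => l.getD j 0 :=
    List.ext_getElem (by simp) fun i h1 h2 => by simp [List.getD, h1]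
  conv_lhs => rw [hl, List.filter_map, List.length_map]
  rfl

theorem getD_chainOfL (T : List (List ℕ)) (x i : ℕ) :
    (chainOfL T x).getD i 0 = chainRow T x i := by
  have h1 : (chainOfL T x).getD i 0 =
      ((T.getD i []).filter fun a => decide (a ≤ x)).length := by
    by_cases hi : i < T.length <;> simp [chainOfL, List.getD, hi]
  rw [h1, length_filter_eq_card]; rfl

theorem nextRow_of_lt {R s x : ℕ} (prev : ℕ → List ℕ) (hs : s ≤ x) :
    nextRow R prev s (x + 1) = localRule (prev x) (prev (x + 1)) (nextRow R prev s x) := by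
  rw [nextRow, if_neg (by omega)]

theorem nextRow_self (R s : ℕ) (prev : ℕ → List ℕ) :
    nextRow R prev s s = List.replicate R 0 := by
  cases s with
  | zero => rfl
  | succ s => rw [nextRow, if_pos le_rfl]

section Stack

variable {r c : ℕ} {P Q : ℕ → ℕ → ℕ}

/-- In columns `x ≤ r * c`, the diagram of `stack P Q` records the chains of the successive
rectified deletions of `P`. -/
theorem PErow_stack_left (hP : IsSYT r c P) (hQ : IsSYT r c Q) {k : ℕ} (hk : k ≤ r * c) :
    ∀ x, k ≤ x → x ≤ r * c → PErow (2 * r) c (stack r c P Q) k x =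
      (List.range (2 * r)).map (chainRow (delta^[k] (toListT r c P)) x) := by
  induction k with
  | zero =>
    intro x _ hx
    refine List.map_congr_left fun i hi => ?_
    have hi2 : i < 2 * r := List.mem_range.1 hi
    have hmin : min x (2 * r * c) = x := min_eq_left (by nlinarith)
    rw [hmin, Function.iterate_zero, id, chainRow, rowLen_toListT]
    by_cases hir : i < r
    · rw [if_pos hir]
      refine congrArg Finset.card (Finset.filter_congr fun j hj => ?_)
      rw [stack, if_pos hir, entryAt_toListT hir (Finset.mem_range.1 hj)]
    · rw [if_neg hir, Finset.range_zero, Finset.filter_empty, Finset.card_empty,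
        Finset.card_eq_zero, Finset.filter_eq_empty_iff]
      intro j hj
      have h1 := (hQ.stdOn.mem (i - r, j)
        (inShape_toListT.2 ⟨by simp only; omega, Finset.mem_range.1 hj⟩)).1
      rw [entryAt_toListT (by omega) (Finset.mem_range.1 hj)] at h1
      rw [stack, if_neg hir]
      omega
  | succ k ih =>
    have hstd := hP.stdOn.delta_iterate (k := k) (by omega)
    have hstd' := hP.stdOn.delta_iterate hk
    intro x hkx
    induction x, hkx using Nat.le_induction with
    | base =>
      intro _
      rw [PErow, nextRow_self]
      exact (List.eq_replicate_iff.2 ⟨by simp, fun b hb => by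
        obtain ⟨i, -, rfl⟩ := List.mem_map.1 hb
        exact hstd'.chainRow_of_le le_rfl i⟩).symm
    | succ x hkx ihx =>
      intro hx
      have h1 := ihx (by omega)
      rw [PErow] at h1 ⊢
      rw [nextRow_of_lt _ hkx, h1, ih (by omega) x (by omega) (by omega),
        ih (by omega) (x + 1) (by omega) hx, Function.iterate_succ_apply']
      refine hstd.localRule_chainRow hk ?_ hkx hx
      have h2 := hP.stdOn.rowLen_delta_iterate_le (k := k) (by omega) (2 * r)
      rw [rowLen_toListT, if_neg (by omega)] at h2
      omega

theorem PErow_stack_middle (hP : IsSYT r c P) (hQ : IsSYT r c Q) {k : ℕ} (hk : k ≤ r * c) :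
    PErow (2 * r) c (stack r c P Q) k (r * c) =
      (List.range (2 * r)).map (rowLen (delta^[k] (toListT r c P))) := by
  rw [PErow_stack_left hP hQ hk _ hk le_rfl]
  exact List.map_congr_left fun i _ => (hP.stdOn.delta_iterate hk).chainRow_of_ge le_rfl i

theorem rowLen_delta_iterate_toListT (hP : IsSYT r c P) {k : ℕ} (hk : k ≤ r * c) :
    rowLen (delta^[k] (toListT r c P)) r = 0 ∧
      ∀ i, rowLen (delta^[k] (toListT r c P)) i ≤ c := by
  have h := hP.stdOn.rowLen_delta_iterate_le hk
  refine ⟨?_, fun i => (h i).trans ?_⟩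
  · have h1 := h r
    rw [rowLen_toListT, if_neg (lt_irrefl r)] at h1
    omega
  · rw [rowLen_toListT]
    split_ifs <;> omega

theorem chainRow_toListT (r c : ℕ) (T : ℕ → ℕ → ℕ) (x : ℕ) :
    chainRow (toListT r c T) x r = 0 ∧ ∀ i, chainRow (toListT r c T) x i ≤ c := by
  have h : ∀ i, chainRow (toListT r c T) x i ≤ rowLen (toListT r c T) i := fun i =>
    (Finset.card_filter_le _ _).trans_eq (Finset.card_range _)
  refine ⟨?_, fun i => (h i).trans ?_⟩
  · have h1 := h r
    rw [rowLen_toListT, if_neg (lt_irrefl r)] at h1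
    omega
  · rw [rowLen_toListT]
    split_ifs <;> omega

/-- Column heights of the partition in row `k`, column `r * c + x` of the diagram of
`stack P Q`. -/
def stackHeight (r c : ℕ) (P Q : ℕ → ℕ → ℕ) (k x j : ℕ) : ℕ :=
  conj r (rowLen (delta^[k] (toListT r c P))) j + conj r (chainRow (toListT r c Q) x) j

theorem antitone_stackHeight (k x : ℕ) : Antitone (stackHeight r c P Q k x) := fun _ _ h =>
  add_le_add (antitone_conj r _ h) (antitone_conj r _ h)

theorem conj_stackHeight_zero_right (hP : IsSYT r c P) (hQ : IsSYT r c Q) {k : ℕ}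
    (hk : k ≤ r * c) (i : ℕ) :
    conj c (stackHeight r c P Q k 0) i = rowLen (delta^[k] (toListT r c P)) i := by
  have h0 : stackHeight r c P Q k 0 = conj r (rowLen (delta^[k] (toListT r c P))) :=
    funext fun j => by
      simp [stackHeight, conj, hQ.stdOn.chainRow_of_le le_rfl]
  have h1 := rowLen_delta_iterate_toListT hP hk
  rw [h0, conj_conj (hP.stdOn.delta_iterate hk).antitone_rowLen h1.1 h1.2]

theorem conj_stackHeight_last (hP : IsSYT r c P) (hQ : IsSYT r c Q) (x i : ℕ) :
    conj c (stackHeight r c P Q (r * c) x) i = chainRow (toListT r c Q) x i := by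
  have h0 : stackHeight r c P Q (r * c) x = conj r (chainRow (toListT r c Q) x) :=
    funext fun j => by
      simp [stackHeight, conj, (hP.stdOn.delta_iterate le_rfl).rowLen_self]
  have h1 := chainRow_toListT r c Q x
  rw [h0, conj_conj (hQ.stdOn.antitone_chainRow x) h1.1 h1.2]

theorem PErow_stack_zero (hP : IsSYT r c P) (hQ : IsSYT r c Q) {x : ℕ} (hx : x ≤ r * c) :
    PErow (2 * r) c (stack r c P Q) 0 (r * c + x) =
      (List.range (2 * r)).map (conj c (stackHeight r c P Q 0 x)) := by
  refine List.map_congr_left fun i hi => ?_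
  have hi2 : i < 2 * r := List.mem_range.1 hi
  have hmin : min (r * c + x) (2 * r * c) = r * c + x := min_eq_left (by nlinarith)
  rw [hmin, conj]
  refine congrArg Finset.card (Finset.filter_congr fun j hj => ?_)
  have hj' := Finset.mem_range.1 hj
  have hfull : conj r (rowLen (delta^[0] (toListT r c P))) j = r := by
    refine eq_of_forall_lt_iff fun i => ?_
    rw [Function.iterate_zero, id, lt_conj_iff hP.stdOn.antitone_rowLen, rowLen_toListT]
    split_ifs with h <;> simp [h, hj']
  rw [stackHeight, hfull, stack]
  split_ifs with hir
  · have h1 := (hP.stdOn.mem (i, j) (inShape_toListT.2 ⟨hir, hj'⟩)).2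
    rw [entryAt_toListT hir hj'] at h1
    omega
  · have h1 : i - r < conj r (chainRow (toListT r c Q) x) j ↔ Q (i - r) j ≤ x := by
      have h2 : InShape (toListT r c Q) (i - r, j) :=
        inShape_toListT.2 ⟨by simp only; omega, hj'⟩
      rw [lt_conj_iff (hQ.stdOn.antitone_chainRow x), hQ.stdOn.lt_chainRow x (i - r, j),
        entryAt_toListT (by omega) hj']
      exact ⟨fun h => h.2.2, fun h => ⟨by omega, h2, h⟩⟩
    omega

/-- The northeast block of the diagram of `stack P Q` consists of vertical sums. -/
theorem PErow_stack_right (hP : IsSYT r c P) (hQ : IsSYT r c Q) {k : ℕ} (hk : k ≤ r * c) :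
    ∀ x ≤ r * c, PErow (2 * r) c (stack r c P Q) k (r * c + x) =
      (List.range (2 * r)).map (conj c (stackHeight r c P Q k x)) := by
  induction k with
  | zero => exact fun x hx => PErow_stack_zero hP hQ hx
  | succ k ih =>
    intro x
    induction x with
    | zero =>
      intro _
      rw [add_zero, PErow_stack_middle hP hQ hk]
      exact List.map_congr_left fun i _ => (conj_stackHeight_zero_right hP hQ hk i).symm
    | succ x ihx =>
      intro hx
      have h1 := ihx (by omega)
      have hk' : k < r * c := hk
      rw [PErow] at h1 ⊢
      rw [← add_assoc, nextRow_of_lt _ (by omega), h1, ih hk'.le x (by omega), add_assoc,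
        ih hk'.le (x + 1) hx]
      have hstd := hP.stdOn.delta_iterate hk'.le
      have hrow : ∀ i, rowLen (delta^[k] (toListT r c P)) i =
          rowLen (delta^[k + 1] (toListT r c P)) i +
            if i = (vacated (delta^[k] (toListT r c P))).1 then 1 else 0 := fun i => by
        have hc := hstd.vacated_corner hk'
        rw [Function.iterate_succ_apply', hstd.rowLen_delta hk']
        split_ifs with hi
        · rw [hi]; omega
        · rfl
      have hlen := rowLen_delta_iterate_toListT hP hk'.le
      have hv := hrow (vacated (delta^[k] (toListT r c P))).1
      have hvc := hlen.2 (vacated (delta^[k] (toListT r c P))).1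
      have hvr : (vacated (delta^[k] (toListT r c P))).1 < r := by
        by_contra hvr
        have := hstd.antitone_rowLen (not_lt.1 hvr)
        rw [if_pos rfl] at hv
        omega
      obtain ⟨p, hp, hpx⟩ := hQ.stdOn.surj (x + 1) (by omega) hx
      have hchain := hQ.stdOn.chainRow_succ hp hpx
      have hpr := (inShape_toListT.1 hp).1
      have hpv := hchain p.1
      have hpc := (chainRow_toListT r c Q (x + 1)).2 p.1
      rw [if_pos rfl] at hv hpv
      have hA := conj_add_single hvr hrow
      have hB := conj_add_single hpr hchain
      refine localRule_conj
        (a := rowLen (delta^[k + 1] (toListT r c P)) (vacated (delta^[k] (toListT r c P))).1)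
        (a' := chainRow (toListT r c Q) x p.1) (by omega) (by omega)
        (fun j => by rw [stackHeight, hB, ← add_assoc, stackHeight])
        (fun j => by rw [stackHeight, hA, add_right_comm, stackHeight])
        (fun j => by rw [stackHeight, hA, add_right_comm, stackHeight])
        (antitone_stackHeight _ _) (antitone_stackHeight _ _) (fun j => ?_)
      rw [two_mul]
      exact add_le_add (conj_le _ _ _) (conj_le _ _ _)

end Stack

/-- For `P, Q ∈ SYT(r × c)`, `n = rc`, `S = stack(P, Q)`, and the
`(n+1) × (n+1)` northeast block of partitions `λ(x, y)` of `PEdiagram(S)`: the chain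
`λ(0,0) → λ(0,1) → ⋯ → λ(0,n)` is the chain of partitions of the evacuation `∂(P)`, and
the chain `λ(0,0) → λ(1,0) → ⋯ → λ(n,0)` is the chain of partitions of `Q`. -/
theorem lamBlock_edges (r c : ℕ) (P Q : ℕ → ℕ → ℕ)
    (hP : IsSYT r c P) (hQ : IsSYT r c Q) :
    (∀ y ≤ r * c, ∀ i : ℕ,
      (lamBlock r c (stack r c P Q) 0 y).getD i 0 =
        (chainOfL (evacL (toListT r c P)) y).getD i 0) ∧
    (∀ x ≤ r * c, ∀ i : ℕ,
      (lamBlock r c (stack r c P Q) x 0).getD i 0 =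
        (chainOfL (toListT r c Q) x).getD i 0) := by
  have hn := Nat.sub_le (r * c)
  refine ⟨fun y hy i => ?_, fun x hx i => ?_⟩
  · rw [getD_chainOfL, hP.stdOn.chainRow_evacL hy, lamBlock, add_zero,
      PErow_stack_middle hP hQ (hn y), getD_map_range]
    split_ifs with hi
    · rfl
    · have h1 := (hP.stdOn.delta_iterate (hn y)).antitone_rowLen (show r ≤ i by omega)
      have h2 := (rowLen_delta_iterate_toListT hP (hn y)).1
      omega
  · rw [getD_chainOfL, lamBlock, Nat.sub_zero, PErow_stack_right hP hQ le_rfl x hx,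
      getD_map_range, conj_stackHeight_last hP hQ]
    split_ifs with hi
    · rfl
    · have h1 := hQ.stdOn.antitone_chainRow x (show r ≤ i by omega)
      have h2 := (chainRow_toListT r c Q x).1
      omega

end PromRS
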